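/- Let p ∈ P and u = G·p + b = ∇ψ(p). Then for every m ∈ S = P ∩ ℤⁿ one has ⟨m, u⟩ − ψ(m) = (1/2)·(‖u − b‖²_{G^{−1}} − ‖p − m‖²_G); consequently the maximizers of m ↦ ⟨m, u⟩ − ψ(m) over S are exactly the lattice points of P nearest to p in the norm ‖·‖_G, and u ∈ A_trop(S, ψ) if and only if at least two distinct lattice points m₁ ≠ m₂ ∈ S satisfy ‖p − m₁‖_G = ‖p − m₂‖_G = min_{m∈S}‖p − m‖_G. -/

import Mathlib

open Set
open scoped RealInnerProductSpace BigOperators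

/-- The set of lattice points of `P ⊆ ℝⁿ`: points of `P` with all coordinates integral. -/
def latticePoints (n : ℕ) (P : Set (EuclideanSpace ℝ (Fin n))) :
    Set (EuclideanSpace ℝ (Fin n)) :=
  {x ∈ P | ∀ i, ∃ z : ℤ, x i = (z : ℝ)}

/-- The tropical amoeba `A_trop(S, v)`: the set of `u ∈ ℝⁿ` where the maximum of
`m ↦ ⟨m, u⟩ − v(m)` over `S` is attained by at least two distinct elements of `S`. -/
def tropicalAmoeba (n : ℕ) (S : Set (EuclideanSpace ℝ (Fin n)))
    (v : EuclideanSpace ℝ (Fin n) → ℝ) : Set (EuclideanSpace ℝ (Fin n)) :=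
  {u | ∃ m₁ ∈ S, ∃ m₂ ∈ S, m₁ ≠ m₂ ∧
    (∀ m ∈ S, ⟪m, u⟫ - v m ≤ ⟪m₁, u⟫ - v m₁) ∧
    ⟪m₁, u⟫ - v m₁ = ⟪m₂, u⟫ - v m₂}

/-- The quadratic form `vᵀ H v` of a matrix `H` on `ℝⁿ`. -/
def quadForm (n : ℕ) (H : Matrix (Fin n) (Fin n) ℝ)
    (v : EuclideanSpace ℝ (Fin n)) : ℝ :=
  ∑ i, ∑ j, v i * H i j * v j

/-- The norm `‖v‖_H = √(vᵀ H v)` associated to a (symmetric positive definite) matrix. -/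
noncomputable def matNorm (n : ℕ) (H : Matrix (Fin n) (Fin n) ℝ)
    (v : EuclideanSpace ℝ (Fin n)) : ℝ :=
  Real.sqrt (quadForm n H v)

section QuadraticForms

variable {n : ℕ}

theorem quadForm_eq_inner_toEuclideanCLM (H : Matrix (Fin n) (Fin n) ℝ)
    (v : EuclideanSpace ℝ (Fin n)) :
    quadForm n H v = ⟪v, Matrix.toEuclideanCLM (𝕜 := ℝ) H v⟫ := by
  simp only [quadForm, PiLp.inner_apply, Matrix.ofLp_toEuclideanCLM, Matrix.mulVec, dotProduct,
    RCLike.inner_apply, conj_trivial, Finset.sum_mul]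
  exact Finset.sum_congr rfl fun i _ => Finset.sum_congr rfl fun j _ => by ring

theorem Matrix.IsSymm.inner_toEuclideanCLM {H : Matrix (Fin n) (Fin n) ℝ} (hH : H.IsSymm)
    (x y : EuclideanSpace ℝ (Fin n)) :
    ⟪Matrix.toEuclideanCLM (𝕜 := ℝ) H x, y⟫ = ⟪x, Matrix.toEuclideanCLM (𝕜 := ℝ) H y⟫ := by
  simp only [PiLp.inner_apply, Matrix.ofLp_toEuclideanCLM, Matrix.mulVec, dotProduct,
    RCLike.inner_apply, conj_trivial, Finset.sum_mul, Finset.mul_sum]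
  rw [Finset.sum_comm]
  refine Finset.sum_congr rfl fun i _ => Finset.sum_congr rfl fun j _ => ?_
  rw [hH.apply i j]
  ring

theorem hasGradientAt_quadForm {H : Matrix (Fin n) (Fin n) ℝ} (hH : H.IsSymm)
    (b p : EuclideanSpace ℝ (Fin n)) :
    HasGradientAt (fun x => (1 / 2) * quadForm n H x + ⟪b, x⟫)
      (Matrix.toEuclideanCLM (𝕜 := ℝ) H p + b) p := by
  rw [hasGradientAt_iff_hasFDerivAt]
  simp only [quadForm_eq_inner_toEuclideanCLM]
  have hq := ((hasFDerivAt_id (𝕜 := ℝ) p).inner ℝ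
    (Matrix.toEuclideanCLM (𝕜 := ℝ) H).hasFDerivAt).const_mul (1 / 2 : ℝ)
  refine (hq.add (innerSL ℝ b).hasFDerivAt).congr_fderiv ?_
  ext h
  have h₁ := hH.inner_toEuclideanCLM p h
  have h₂ := real_inner_comm h (Matrix.toEuclideanCLM (𝕜 := ℝ) H p)
  simp
  linarith

theorem quadForm_sub {H : Matrix (Fin n) (Fin n) ℝ} (hH : H.IsSymm)
    (x y : EuclideanSpace ℝ (Fin n)) :
    quadForm n H (x - y) =
      quadForm n H x - 2 * ⟪y, Matrix.toEuclideanCLM (𝕜 := ℝ) H x⟫ + quadForm n H y := by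
  have h₁ := hH.inner_toEuclideanCLM x y
  have h₂ := real_inner_comm y (Matrix.toEuclideanCLM (𝕜 := ℝ) H x)
  simp only [quadForm_eq_inner_toEuclideanCLM, map_sub, inner_sub_left, inner_sub_right]
  linarith

theorem quadForm_inv_toEuclideanCLM {H : Matrix (Fin n) (Fin n) ℝ} (hH : IsUnit H.det)
    (x : EuclideanSpace ℝ (Fin n)) :
    quadForm n H⁻¹ (Matrix.toEuclideanCLM (𝕜 := ℝ) H x) = quadForm n H x := by
  have h : Matrix.toEuclideanCLM (𝕜 := ℝ) H⁻¹ (Matrix.toEuclideanCLM (𝕜 := ℝ) H x) = x := by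
    rw [← mul_apply_eq_comp, ← map_mul, Matrix.nonsing_inv_mul _ hH, map_one,
      one_apply_eq_self]
  rw [quadForm_eq_inner_toEuclideanCLM, quadForm_eq_inner_toEuclideanCLM, h, real_inner_comm]

theorem Matrix.PosDef.quadForm_nonneg {H : Matrix (Fin n) (Fin n) ℝ} (hH : H.PosDef)
    (v : EuclideanSpace ℝ (Fin n)) : 0 ≤ quadForm n H v := by
  have h := hH.posSemidef.dotProduct_mulVec_nonneg v.ofLp
  simpa [quadForm, dotProduct, Matrix.mulVec, Finset.mul_sum, mul_assoc] using h

theorem matNorm_le_matNorm_iff {H : Matrix (Fin n) (Fin n) ℝ} (hH : H.PosDef)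
    (v w : EuclideanSpace ℝ (Fin n)) :
    matNorm n H v ≤ matNorm n H w ↔ quadForm n H v ≤ quadForm n H w :=
  Real.sqrt_le_sqrt_iff (hH.quadForm_nonneg w)

theorem matNorm_eq_matNorm_iff {H : Matrix (Fin n) (Fin n) ℝ} (hH : H.PosDef)
    (v w : EuclideanSpace ℝ (Fin n)) :
    matNorm n H v = matNorm n H w ↔ quadForm n H v = quadForm n H w :=
  Real.sqrt_inj (hH.quadForm_nonneg v) (hH.quadForm_nonneg w)

end QuadraticForms

/-- tropical amoeba of a quadratic valuation via nearest lattice points.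
Let `P ⊆ ℝⁿ` be a compact lattice polytope and `ψ(x) = ½ xᵀGx + bᵀx` with `G` symmetric
positive definite.  Let `p ∈ P` and `u = G·p + b = ∇ψ(p)`.  Then for every lattice point
`m ∈ P ∩ ℤⁿ`, `⟨m, u⟩ − ψ(m) = ½(‖u − b‖²_{G⁻¹} − ‖p − m‖²_G)`; consequently the
maximizers of `m ↦ ⟨m, u⟩ − ψ(m)` are exactly the lattice points of `P` nearest to `p` in
`‖·‖_G`, and `u ∈ A_trop(P ∩ ℤⁿ, ψ)` iff at least two distinct lattice points of `P` are
at minimal `‖·‖_G`-distance from `p`. -/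
theorem quadratic_tropical_amoeba_nearest_points {n : ℕ}
    (P : Set (EuclideanSpace ℝ (Fin n)))
    (hPcomp : IsCompact P)
    (hlatne : (latticePoints n P).Nonempty) (hlatfin : (latticePoints n P).Finite)
    (hhull : P = convexHull ℝ (latticePoints n P))
    (G : Matrix (Fin n) (Fin n) ℝ) (hGsym : G.IsSymm) (hGpd : G.PosDef)
    (b : EuclideanSpace ℝ (Fin n))
    (ψ : EuclideanSpace ℝ (Fin n) → ℝ)
    (hψdef : ∀ x, ψ x = (1 / 2) * quadForm n G x + ⟪b, x⟫)
    (p : EuclideanSpace ℝ (Fin n)) (hp : p ∈ P)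
    (u : EuclideanSpace ℝ (Fin n))
    (hu : ∀ i, u i = (∑ j, G i j * p j) + b i) :
    gradient ψ p = u ∧
    (∀ m ∈ latticePoints n P,
      ⟪m, u⟫ - ψ m = (1 / 2) * (quadForm n G⁻¹ (u - b) - quadForm n G (p - m))) ∧
    (∀ m₁ ∈ latticePoints n P,
      ((∀ m ∈ latticePoints n P, ⟪m, u⟫ - ψ m ≤ ⟪m₁, u⟫ - ψ m₁) ↔
        (∀ m ∈ latticePoints n P, matNorm n G (p - m₁) ≤ matNorm n G (p - m)))) ∧
    (u ∈ tropicalAmoeba n (latticePoints n P) ψ ↔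
      ∃ m₁ ∈ latticePoints n P, ∃ m₂ ∈ latticePoints n P, m₁ ≠ m₂ ∧
        matNorm n G (p - m₁) = matNorm n G (p - m₂) ∧
        ∀ m ∈ latticePoints n P, matNorm n G (p - m₁) ≤ matNorm n G (p - m)) := by
  have hu' : u = Matrix.toEuclideanCLM (𝕜 := ℝ) G p + b := by
    ext i
    simp [hu, Matrix.mulVec, dotProduct]
  have hform : ∀ m, ⟪m, u⟫ - ψ m =
      (1 / 2) * (quadForm n G⁻¹ (u - b) - quadForm n G (p - m)) := by
    intro m
    rw [hu', add_sub_cancel_right, quadForm_inv_toEuclideanCLM hGpd.det_pos.ne'.isUnit,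
      quadForm_sub hGsym, hψdef, inner_add_right, real_inner_comm b m]
    ring
  have hle : ∀ m m₁, ⟪m, u⟫ - ψ m ≤ ⟪m₁, u⟫ - ψ m₁ ↔
      matNorm n G (p - m₁) ≤ matNorm n G (p - m) := by
    intro m m₁
    rw [hform, hform, matNorm_le_matNorm_iff hGpd]
    constructor <;> intro h <;> linarith
  have heq : ∀ m₁ m₂, ⟪m₁, u⟫ - ψ m₁ = ⟪m₂, u⟫ - ψ m₂ ↔
      matNorm n G (p - m₁) = matNorm n G (p - m₂) := by
    intro m₁ m₂
    rw [hform, hform, matNorm_eq_matNorm_iff hGpd]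
    constructor <;> intro h <;> linarith
  refine ⟨?_, fun m _ => hform m, fun m₁ _ => by simp only [hle], ?_⟩
  · rw [funext hψdef, hu']
    exact (hasGradientAt_quadForm hGsym b p).gradient
  · simp only [tropicalAmoeba, mem_ofPred_eq, hle, heq,
      and_comm (a := ∀ m ∈ latticePoints n P, _)]
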